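/- arXiv:2101.10379 — 7 statements merged into one kernel-verified Lean document; each statement's English description precedes it below -/
import Mathlib

section
/- Let V be a 2-generated primitive axial algebra of Monster type (α, β) over F with generating axes a₀, a₁. For every n ≥ 1 and all i, j ∈ ℤ with i ≡ j (mod n), one has a_i·a_{i+n} − β(a_i + a_{i+n}) = a_j·a_{j+n} − β(a_j + a_{j+n}). -/
/-- The `δ`-eigenspace of the adjoint action of `a` on `V`. -/
def eigSp (F : Type*) [Field F] {V : Type*} [NonUnitalNonAssocCommRing V]
    [Module F V] [SMulCommClass F V V] [IsScalarTower F V V]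
    (a : V) (δ : F) : Submodule F V where
  carrier := {v | a * v = δ • v}
  add_mem' := by
    intro x y hx hy
    simp only [Set.mem_setOf_eq] at *
    rw [mul_add, hx, hy, smul_add]
  zero_mem' := by
    simp
  smul_mem' := by
    intro c x hx
    simp only [Set.mem_setOf_eq] at *
    rw [mul_smul_comm, hx, smul_comm]

/-- `τ` is the Miyamoto involution associated with the axis `a`:  it is the identity on the
`1`-, `0`- and `α`-eigenspaces of `ad a` and `-1` on the `β`-eigenspace. -/
def IsMiyamoto (F : Type*) [Field F] {V : Type*} [NonUnitalNonAssocCommRing V]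
    [Module F V] [SMulCommClass F V V] [IsScalarTower F V V]
    (α β : F) (a : V) (τ : V ≃ₗ[F] V) : Prop :=
  (∀ v ∈ eigSp F a 1, τ v = v) ∧ (∀ v ∈ eigSp F a 0, τ v = v) ∧
    (∀ v ∈ eigSp F a α, τ v = v) ∧ (∀ v ∈ eigSp F a β, τ v = -v)

/-- `a` is a primitive axis of Monster type `(α, β)`:  `a` is idempotent, `V` decomposes as the
sum of the eigenspaces of `ad a` for the eigenvalues `1, 0, α, β`, the fusion law
M(α, β) holds, and the `1`-eigenspace is spanned by `a` (primitivity). -/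
structure IsAxis (F : Type*) [Field F] {V : Type*} [NonUnitalNonAssocCommRing V]
    [Module F V] [SMulCommClass F V V] [IsScalarTower F V V]
    (α β : F) (a : V) : Prop where
  idem : a * a = a
  semisimple : eigSp F a 1 ⊔ eigSp F a 0 ⊔ eigSp F a α ⊔ eigSp F a β = ⊤
  primitive : eigSp F a 1 = Submodule.span F {a}
  fusion11 : ∀ u ∈ eigSp F a 1, ∀ v ∈ eigSp F a 1, u * v ∈ eigSp F a 1
  fusion10 : ∀ u ∈ eigSp F a 1, ∀ v ∈ eigSp F a 0, u * v = 0
  fusion1a : ∀ u ∈ eigSp F a 1, ∀ v ∈ eigSp F a α, u * v ∈ eigSp F a α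
  fusion1b : ∀ u ∈ eigSp F a 1, ∀ v ∈ eigSp F a β, u * v ∈ eigSp F a β
  fusion00 : ∀ u ∈ eigSp F a 0, ∀ v ∈ eigSp F a 0, u * v ∈ eigSp F a 0
  fusion0a : ∀ u ∈ eigSp F a 0, ∀ v ∈ eigSp F a α, u * v ∈ eigSp F a α
  fusion0b : ∀ u ∈ eigSp F a 0, ∀ v ∈ eigSp F a β, u * v ∈ eigSp F a β
  fusionaa : ∀ u ∈ eigSp F a α, ∀ v ∈ eigSp F a α, u * v ∈ eigSp F a 1 ⊔ eigSp F a 0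
  fusionab : ∀ u ∈ eigSp F a α, ∀ v ∈ eigSp F a β, u * v ∈ eigSp F a β
  fusionbb : ∀ u ∈ eigSp F a β, ∀ v ∈ eigSp F a β,
    u * v ∈ eigSp F a 1 ⊔ eigSp F a 0 ⊔ eigSp F a α

/-- The sequence of axes `a i` (`i ∈ ℤ`) generated from `a₀`, `a₁` by the Miyamoto
involutions:  with `σ = τ₁ ∘ τ₀`, `a (2*i) = σ^i a₀` and `a (2*i+1) = σ^i a₁`. -/
noncomputable def aSeq {F : Type*} [Field F] {V : Type*} [NonUnitalNonAssocCommRing V]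
    [Module F V] [SMulCommClass F V V] [IsScalarTower F V V]
    (a₀ a₁ : V) (τ₀ τ₁ : V ≃ₗ[F] V) (i : ℤ) : V :=
  if i % 2 = 0 then ((τ₁ * τ₀) ^ (i / 2)) a₀ else ((τ₁ * τ₀) ^ ((i - 1) / 2)) a₁

/-- `s r n = a r * a (r+n) - β • (a r + a (r+n))`. -/
noncomputable def sSeq {F : Type*} [Field F] {V : Type*} [NonUnitalNonAssocCommRing V]
    [Module F V] [SMulCommClass F V V] [IsScalarTower F V V]
    (β : F) (a₀ a₁ : V) (τ₀ τ₁ : V ≃ₗ[F] V) (r n : ℤ) : V :=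
  aSeq a₀ a₁ τ₀ τ₁ r * aSeq a₀ a₁ τ₀ τ₁ (r + n)
    - β • (aSeq a₀ a₁ τ₀ τ₁ r + aSeq a₀ a₁ τ₀ τ₁ (r + n))

section Miyamoto

variable {F : Type*} [Field F] {V : Type*} [NonUnitalNonAssocCommRing V]
    [Module F V] [SMulCommClass F V V] [IsScalarTower F V V] {α β : F} {a : V} {τ : V ≃ₗ[F] V}

theorem mem_eigSp_iff {δ : F} {v : V} : v ∈ eigSp F a δ ↔ a * v = δ • v := Iff.rfl

theorem IsAxis.self_mem (h : IsAxis F α β a) : a ∈ eigSp F a 1 := by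
  rw [mem_eigSp_iff, h.idem, one_smul]

theorem IsAxis.exists_decomp (h : IsAxis F α β a) (v : V) :
    ∃ x ∈ eigSp F a 1 ⊔ eigSp F a 0 ⊔ eigSp F a α, ∃ y ∈ eigSp F a β, x + y = v :=
  Submodule.mem_sup.1 (h.semisimple ▸ Submodule.mem_top)

/-- The even part of the grading is closed under multiplication. -/
theorem IsAxis.even_mul_even (h : IsAxis F α β a) {x y : V}
    (hx : x ∈ eigSp F a 1 ⊔ eigSp F a 0 ⊔ eigSp F a α)
    (hy : y ∈ eigSp F a 1 ⊔ eigSp F a 0 ⊔ eigSp F a α) :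
    x * y ∈ eigSp F a 1 ⊔ eigSp F a 0 ⊔ eigSp F a α := by
  have le10 : eigSp F a 1 ⊔ eigSp F a 0 ≤ eigSp F a 1 ⊔ eigSp F a 0 ⊔ eigSp F a α := le_sup_left
  have le1 := le_sup_left.trans le10
  have le0 := le_sup_right.trans le10
  have leα : eigSp F a α ≤ eigSp F a 1 ⊔ eigSp F a 0 ⊔ eigSp F a α := le_sup_right
  obtain ⟨x', hx', xα, hxα, rfl⟩ := Submodule.mem_sup.1 hx
  obtain ⟨x1, hx1, x0, hx0, rfl⟩ := Submodule.mem_sup.1 hx'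
  obtain ⟨y', hy', yα, hyα, rfl⟩ := Submodule.mem_sup.1 hy
  obtain ⟨y1, hy1, y0, hy0, rfl⟩ := Submodule.mem_sup.1 hy'
  have h01 : x0 * y1 = 0 := by rw [mul_comm]; exact h.fusion10 _ hy1 _ hx0
  have hα1 : xα * y1 ∈ eigSp F a α := by rw [mul_comm]; exact h.fusion1a _ hy1 _ hxα
  have hα0 : xα * y0 ∈ eigSp F a α := by rw [mul_comm]; exact h.fusion0a _ hy0 _ hxα
  simp only [add_mul, mul_add, h01, h.fusion10 _ hx1 _ hy0]
  have m11 := le1 (h.fusion11 _ hx1 _ hy1)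
  have m1α := leα (h.fusion1a _ hx1 _ hyα)
  have m00 := le0 (h.fusion00 _ hx0 _ hy0)
  have m0α := leα (h.fusion0a _ hx0 _ hyα)
  have mαα := le10 (h.fusionaa _ hxα _ hyα)
  have mα1 := leα hα1
  have mα0 := leα hα0
  repeat' first | assumption | exact zero_mem _ | apply add_mem

theorem IsAxis.even_mul_odd (h : IsAxis F α β a) {x y : V}
    (hx : x ∈ eigSp F a 1 ⊔ eigSp F a 0 ⊔ eigSp F a α) (hy : y ∈ eigSp F a β) :
    x * y ∈ eigSp F a β := by
  obtain ⟨x', hx', xα, hxα, rfl⟩ := Submodule.mem_sup.1 hx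
  obtain ⟨x1, hx1, x0, hx0, rfl⟩ := Submodule.mem_sup.1 hx'
  rw [add_mul, add_mul]
  exact add_mem (add_mem (h.fusion1b _ hx1 _ hy) (h.fusion0b _ hx0 _ hy)) (h.fusionab _ hxα _ hy)

theorem IsMiyamoto.map_even (hτ : IsMiyamoto F α β a τ) {x : V}
    (hx : x ∈ eigSp F a 1 ⊔ eigSp F a 0 ⊔ eigSp F a α) : τ x = x := by
  obtain ⟨x', hx', xα, hxα, rfl⟩ := Submodule.mem_sup.1 hx
  obtain ⟨x1, hx1, x0, hx0, rfl⟩ := Submodule.mem_sup.1 hx'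
  rw [map_add, map_add, hτ.1 _ hx1, hτ.2.1 _ hx0, hτ.2.2.1 _ hxα]

theorem IsMiyamoto.map_odd (hτ : IsMiyamoto F α β a τ) {y : V} (hy : y ∈ eigSp F a β) :
    τ y = -y :=
  hτ.2.2.2 y hy

theorem IsMiyamoto.map_self (hτ : IsMiyamoto F α β a τ) (h : IsAxis F α β a) : τ a = a :=
  hτ.1 a h.self_mem

theorem IsMiyamoto.map_mul (hτ : IsMiyamoto F α β a τ) (h : IsAxis F α β a) (u v : V) :
    τ (u * v) = τ u * τ v := by
  obtain ⟨x, hx, y, hy, rfl⟩ := h.exists_decomp u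
  obtain ⟨x', hx', y', hy', rfl⟩ := h.exists_decomp v
  have hyx : y * x' ∈ eigSp F a β := by rw [mul_comm]; exact h.even_mul_odd hx' hy
  simp only [add_mul, mul_add, map_add, hτ.map_even hx, hτ.map_even hx', hτ.map_odd hy,
    hτ.map_odd hy', hτ.map_even (h.even_mul_even hx hx'), hτ.map_odd (h.even_mul_odd hx hy'),
    hτ.map_odd hyx, hτ.map_even (h.fusionbb _ hy _ hy'), neg_mul, mul_neg]
  abel

theorem IsMiyamoto.mul_self (hτ : IsMiyamoto F α β a τ) (h : IsAxis F α β a) : τ * τ = 1 := by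
  ext v
  obtain ⟨x, hx, y, hy, rfl⟩ := h.exists_decomp v
  simp [hτ.map_even hx, hτ.map_odd hy]

/-- `a * v - β • (a + v)` has no component in the `β`-eigenspace of `a`. -/
theorem IsMiyamoto.map_mul_sub (hτ : IsMiyamoto F α β a τ) (h : IsAxis F α β a) (v : V) :
    τ (a * v - β • (a + v)) = a * v - β • (a + v) := by
  obtain ⟨x, hx, y, hy, rfl⟩ := h.exists_decomp v
  have ha : a ∈ eigSp F a 1 ⊔ eigSp F a 0 ⊔ eigSp F a α :=
    Submodule.mem_sup_left (Submodule.mem_sup_left h.self_mem)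
  have key : a * (x + y) - β • (a + (x + y)) = a * x - β • (a + x) := by
    rw [mul_add, mem_eigSp_iff.1 hy, ← add_assoc a x y, smul_add β (a + x) y]
    abel
  rw [key]
  exact hτ.map_even (sub_mem (h.even_mul_even ha hx) (Submodule.smul_mem _ _ (add_mem ha hx)))

end Miyamoto

section Sequence

variable {F : Type*} [Field F] {V : Type*} [NonUnitalNonAssocCommRing V]
    [Module F V] [SMulCommClass F V V] [IsScalarTower F V V] {α β : F} {a₀ a₁ : V}
    {τ₀ τ₁ : V ≃ₗ[F] V}

theorem aSeq_two_mul (k : ℤ) : aSeq a₀ a₁ τ₀ τ₁ (2 * k) = ((τ₁ * τ₀) ^ k) a₀ := by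
  rw [aSeq, if_pos (by omega), show 2 * k / 2 = k by omega]

theorem aSeq_two_mul_add_one (k : ℤ) :
    aSeq a₀ a₁ τ₀ τ₁ (2 * k + 1) = ((τ₁ * τ₀) ^ k) a₁ := by
  rw [aSeq, if_neg (by omega), show (2 * k + 1 - 1) / 2 = k by omega]

theorem zpow_aSeq (k j : ℤ) :
    ((τ₁ * τ₀) ^ k) (aSeq a₀ a₁ τ₀ τ₁ j) = aSeq a₀ a₁ τ₀ τ₁ (j + 2 * k) := by
  obtain ⟨m, rfl | rfl⟩ := Int.even_or_odd' j
  · rw [← mul_add, aSeq_two_mul, aSeq_two_mul, add_comm m k, zpow_add, LinearEquiv.mul_apply]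
  · rw [show 2 * m + 1 + 2 * k = 2 * (k + m) + 1 by ring, aSeq_two_mul_add_one,
      aSeq_two_mul_add_one, zpow_add, LinearEquiv.mul_apply]

/-- Conjugation by the involution `s` inverts `t * s`. -/
theorem mul_zpow_eq_zpow_neg_mul {G : Type*} [Group G] {s t : G} (hs : s * s = 1) (ht : t * t = 1)
    (k : ℤ) : s * (t * s) ^ k = (t * s) ^ (-k) * s := by
  have h : SemiconjBy s (t * s) (t * s)⁻¹ := by
    rw [SemiconjBy, mul_inv_rev, inv_eq_of_mul_eq_one_left hs, inv_eq_of_mul_eq_one_left ht,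
      mul_assoc]
  rw [zpow_neg, ← inv_zpow]
  exact (h.zpow_right k).eq

theorem map_zero_aSeq (ha₀ : IsAxis F α β a₀) (ha₁ : IsAxis F α β a₁)
    (hτ₀ : IsMiyamoto F α β a₀ τ₀) (hτ₁ : IsMiyamoto F α β a₁ τ₁) (j : ℤ) :
    τ₀ (aSeq a₀ a₁ τ₀ τ₁ j) = aSeq a₀ a₁ τ₀ τ₁ (-j) := by
  have h₀ := hτ₀.mul_self ha₀
  have h₁ := hτ₁.mul_self ha₁
  obtain ⟨k, rfl | rfl⟩ := Int.even_or_odd' j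
  · rw [← mul_neg, aSeq_two_mul, aSeq_two_mul, ← LinearEquiv.mul_apply,
      mul_zpow_eq_zpow_neg_mul h₀ h₁, LinearEquiv.mul_apply, hτ₀.map_self ha₀]
  · have h : τ₀ a₁ = ((τ₁ * τ₀) ^ (-1 : ℤ)) a₁ := by
      rw [zpow_neg_one, mul_inv_rev, inv_eq_of_mul_eq_one_left h₀,
        inv_eq_of_mul_eq_one_left h₁, LinearEquiv.mul_apply, hτ₁.map_self ha₁]
    rw [show -(2 * k + 1) = 2 * (-k + -1) + 1 by ring, aSeq_two_mul_add_one,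
      aSeq_two_mul_add_one, ← LinearEquiv.mul_apply, mul_zpow_eq_zpow_neg_mul h₀ h₁,
      LinearEquiv.mul_apply, h, zpow_add, LinearEquiv.mul_apply]

theorem map_one_aSeq (ha₀ : IsAxis F α β a₀) (ha₁ : IsAxis F α β a₁)
    (hτ₀ : IsMiyamoto F α β a₀ τ₀) (hτ₁ : IsMiyamoto F α β a₁ τ₁) (j : ℤ) :
    τ₁ (aSeq a₀ a₁ τ₀ τ₁ j) = aSeq a₀ a₁ τ₀ τ₁ (2 - j) := by
  have h := zpow_aSeq (a₀ := a₀) (a₁ := a₁) (τ₀ := τ₀) (τ₁ := τ₁) 1 (-j)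
  rw [zpow_one, LinearEquiv.mul_apply, map_zero_aSeq ha₀ ha₁ hτ₀ hτ₁, neg_neg] at h
  rw [h]
  congr 1
  ring

theorem zpow_map_mul (ha₀ : IsAxis F α β a₀) (ha₁ : IsAxis F α β a₁)
    (hτ₀ : IsMiyamoto F α β a₀ τ₀) (hτ₁ : IsMiyamoto F α β a₁ τ₁) (k : ℤ) (u v : V) :
    ((τ₁ * τ₀) ^ k) (u * v) = ((τ₁ * τ₀) ^ k) u * ((τ₁ * τ₀) ^ k) v := by
  induction k with
  | zero => simp
  | succ k ih =>
    simp only [add_comm (k : ℤ), zpow_one_add,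
      LinearEquiv.mul_apply, ih, hτ₀.map_mul ha₀, hτ₁.map_mul ha₁]
  | pred k ih =>
    have hinv : (τ₁ * τ₀)⁻¹ = τ₀ * τ₁ := by
      rw [mul_inv_rev, inv_eq_of_mul_eq_one_left (hτ₀.mul_self ha₀),
        inv_eq_of_mul_eq_one_left (hτ₁.mul_self ha₁)]
    rw [sub_eq_neg_add, zpow_add, zpow_neg_one, hinv]
    simp only [LinearEquiv.mul_apply, ih, hτ₀.map_mul ha₀, hτ₁.map_mul ha₁]

theorem zpow_sSeq (ha₀ : IsAxis F α β a₀) (ha₁ : IsAxis F α β a₁)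
    (hτ₀ : IsMiyamoto F α β a₀ τ₀) (hτ₁ : IsMiyamoto F α β a₁ τ₁) (k r n : ℤ) :
    ((τ₁ * τ₀) ^ k) (sSeq β a₀ a₁ τ₀ τ₁ r n) = sSeq β a₀ a₁ τ₀ τ₁ (r + 2 * k) n := by
  rw [sSeq, sSeq, map_sub, map_smul, map_add, zpow_map_mul ha₀ ha₁ hτ₀ hτ₁, zpow_aSeq,
    zpow_aSeq, add_right_comm r n]

/-- Swapping the two axes in `sSeq`. -/
theorem sSeq_neg (r n : ℤ) : sSeq β a₀ a₁ τ₀ τ₁ r (-n) = sSeq β a₀ a₁ τ₀ τ₁ (r - n) n := by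
  rw [sSeq, sSeq, sub_add_cancel, ← sub_eq_add_neg, mul_comm, add_comm]

theorem sSeq_sub_period (ha₀ : IsAxis F α β a₀) (ha₁ : IsAxis F α β a₁)
    (hτ₀ : IsMiyamoto F α β a₀ τ₀) (hτ₁ : IsMiyamoto F α β a₁ τ₁) (r n : ℤ) :
    sSeq β a₀ a₁ τ₀ τ₁ (r - n) n = sSeq β a₀ a₁ τ₀ τ₁ r n := by
  have aSeq_zero : aSeq a₀ a₁ τ₀ τ₁ 0 = a₀ := by simp [aSeq]
  have aSeq_one : aSeq a₀ a₁ τ₀ τ₁ 1 = a₁ := by simp [aSeq]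
  have s_zero : sSeq β a₀ a₁ τ₀ τ₁ 0 (-n) = sSeq β a₀ a₁ τ₀ τ₁ 0 n := by
    have h := hτ₀.map_mul_sub ha₀ (aSeq a₀ a₁ τ₀ τ₁ n)
    rw [map_sub, map_smul, map_add, hτ₀.map_mul ha₀, hτ₀.map_self ha₀,
      map_zero_aSeq ha₀ ha₁ hτ₀ hτ₁] at h
    simpa only [sSeq, aSeq_zero, zero_add] using h
  have s_one : sSeq β a₀ a₁ τ₀ τ₁ 1 (-n) = sSeq β a₀ a₁ τ₀ τ₁ 1 n := by
    have h := hτ₁.map_mul_sub ha₁ (aSeq a₀ a₁ τ₀ τ₁ (1 + n))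
    rw [map_sub, map_smul, map_add, hτ₁.map_mul ha₁, hτ₁.map_self ha₁,
      map_one_aSeq ha₀ ha₁ hτ₀ hτ₁, show 2 - (1 + n) = 1 + -n by ring] at h
    simpa only [sSeq, aSeq_one] using h
  rw [← sSeq_neg]
  obtain ⟨k, rfl | rfl⟩ := Int.even_or_odd' r
  · rw [← zero_add (2 * k), ← zpow_sSeq ha₀ ha₁ hτ₀ hτ₁, ← zpow_sSeq ha₀ ha₁ hτ₀ hτ₁, s_zero]
  · rw [add_comm (2 * k), ← zpow_sSeq ha₀ ha₁ hτ₀ hτ₁, ← zpow_sSeq ha₀ ha₁ hτ₀ hτ₁, s_one]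

end Sequence

/-- For every `n ≥ 1` and all `i ≡ j (mod n)`, one has
`a i * a (i+n) - β (a i + a (i+n)) = a j * a (j+n) - β (a j + a (j+n))`. -/
theorem stmt9 (F : Type*) [Field F] (V : Type*) [NonUnitalNonAssocCommRing V]
    [Module F V] [SMulCommClass F V V] [IsScalarTower F V V]
    (α β : F) (hα0 : α ≠ 0) (hα1 : α ≠ 1) (hβ0 : β ≠ 0) (hβ1 : β ≠ 1) (hαβ : α ≠ β)
    (a₀ a₁ : V) (ha₀ : IsAxis F α β a₀) (ha₁ : IsAxis F α β a₁)
    (hgen : NonUnitalAlgebra.adjoin F {a₀, a₁} = ⊤)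
    (τ₀ τ₁ : V ≃ₗ[F] V)
    (hτ₀ : IsMiyamoto F α β a₀ τ₀) (hτ₁ : IsMiyamoto F α β a₁ τ₁) :
    ∀ n : ℕ, 1 ≤ n → ∀ i j : ℤ, Int.ModEq (n : ℤ) i j →
      aSeq a₀ a₁ τ₀ τ₁ i * aSeq a₀ a₁ τ₀ τ₁ (i + n) - β • (aSeq a₀ a₁ τ₀ τ₁ i + aSeq a₀ a₁ τ₀ τ₁ (i + n)) =
        aSeq a₀ a₁ τ₀ τ₁ j * aSeq a₀ a₁ τ₀ τ₁ (j + n) - β • (aSeq a₀ a₁ τ₀ τ₁ j + aSeq a₀ a₁ τ₀ τ₁ (j + n)) := by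
  intro n _ i j hij
  obtain ⟨m, hm⟩ := hij.dvd
  obtain rfl : j = i + m * n := by linarith
  have periodic : Function.Periodic (fun r => sSeq β a₀ a₁ τ₀ τ₁ r n) n := fun r => by
    simpa using (sSeq_sub_period ha₀ ha₁ hτ₀ hτ₁ (r + n) n).symm
  exact (periodic.int_mul m i).symm
end

section
/- Let a be an axis of V with α invertible in F and char(F) ≠ 2. Let b ∈ V have eigendecomposition b = λa + u + v + w with λ ∈ F, u ∈ V_0^a, v ∈ V_α^a, w ∈ V_β^a, let b' = τ_a(b) = λa + u + v − w, and set s = a·b − β(a + b). Then: (1) u = (1/α)·((λ − β − αλ)a + ((α − β)/2)(b + b') − s); (2) v = (1/α)·((β − λ)a + (β/2)(b + b') + s); (3) w = (b − b')/2. -/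
/-- The eigencomponents of `b = λ a + u + v + w` with respect to an axis `a` can be expressed
in terms of `b`, `b' = τ_a b = λ a + u + v - w` and `s = a*b - β(a + b)`. -/
theorem stmt10 (F : Type*) [Field F] (V : Type*) [NonUnitalNonAssocCommRing V]
    [Module F V] [SMulCommClass F V V] [IsScalarTower F V V]
    (α β : F) (hα0 : α ≠ 0) (hα1 : α ≠ 1) (hβ0 : β ≠ 0) (hβ1 : β ≠ 1) (hαβ : α ≠ β)
    (hchar : (2 : F) ≠ 0)
    (a : V) (ha : a * a = a)
    (hass : eigSp F a 1 ⊔ eigSp F a 0 ⊔ eigSp F a α ⊔ eigSp F a β = ⊤)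
    (b : V) (l : F) (u v w : V)
    (hu : u ∈ eigSp F a 0) (hv : v ∈ eigSp F a α) (hw : w ∈ eigSp F a β)
    (hb : b = l • a + u + v + w) :
    (∀ τ : V ≃ₗ[F] V, IsMiyamoto F α β a τ → τ b = l • a + u + v - w) ∧
      u = (1 / α) • ((l - β - α * l) • a
        + ((α - β) / 2) • (b + (l • a + u + v - w))
        - (a * b - β • (a + b))) ∧
      v = (1 / α) • ((β - l) • a
        + (β / 2) • (b + (l • a + u + v - w))
        + (a * b - β • (a + b))) ∧
      w = (1 / 2 : F) • (b - (l • a + u + v - w)) := by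
  have hmem : ∀ (δ : F) (x : V), x ∈ eigSp F a δ ↔ a * x = δ • x := fun _ _ => Iff.rfl
  have hs : a * b = l • a + α • v + β • w := by
    rw [hb, mul_add, mul_add, mul_add, mul_smul_comm, ha, (hmem 0 u).1 hu, (hmem α v).1 hv,
      (hmem β w).1 hw, zero_smul, add_zero]
  refine ⟨?_, ?_, ?_, ?_⟩
  · rintro τ ⟨h1, h0, hα, hβ⟩
    have ha1 : a ∈ eigSp F a 1 := (hmem 1 a).2 (by rw [ha, one_smul])
    rw [hb, map_add, map_add, map_add, map_smul, h1 a ha1, h0 u hu, hα v hv, hβ w hw,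
      ← sub_eq_add_neg]
  all_goals
    try rw [hs]
    rw [hb]
    match_scalars <;> field_simp <;> ring
end

section
/- Let a be an axis of V, let I be an ideal of V (an F-subspace with V·I ⊆ I), and let x ∈ V have eigendecomposition x = x₁ + x₀ + x_α + x_β with x_δ ∈ V_δ^a for δ ∈ {1, 0, α, β}. If x ∈ I, then x₁, x₀, x_α, x_β all lie in I. Moreover, I is invariant under the Miyamoto map τ_a, i.e. τ_a(I) ⊆ I. -/
/-- If a sum of four eigenvectors for `ad a` lies in a subspace stable under `ad a`, and the first
eigenvalue differs from the other three, then the first eigenvector lies in the subspace. -/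
theorem mem_of_add_mem_of_mem_eigSp {F : Type*} [Field F] {V : Type*}
    [NonUnitalNonAssocCommRing V] [Module F V] [SMulCommClass F V V] [IsScalarTower F V V]
    {p q r s : F} (hq : p ≠ q) (hr : p ≠ r) (hs : p ≠ s) {a : V} {I : Submodule F V}
    (hI : ∀ x ∈ I, a * x ∈ I) {u v w t : V} (hu : u ∈ eigSp F a p) (hv : v ∈ eigSp F a q)
    (hw : w ∈ eigSp F a r) (ht : t ∈ eigSp F a s) (h : u + v + w + t ∈ I) : u ∈ I := by
  replace hu : a * u = p • u := hu
  replace hv : a * v = q • v := hv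
  replace hw : a * w = r • w := hw
  replace ht : a * t = s • t := ht
  have step : ∀ (δ : F) (x : V), x ∈ I → a * x - δ • x ∈ I := fun δ x hx =>
    I.sub_mem (hI x hx) (I.smul_mem δ hx)
  have key := step q _ (step r _ (step s _ h))
  have hprod : (p - q) * (p - r) * (p - s) ≠ 0 :=
    mul_ne_zero (mul_ne_zero (sub_ne_zero.2 hq) (sub_ne_zero.2 hr)) (sub_ne_zero.2 hs)
  refine (I.smul_mem_iff hprod).1 ?_
  convert key using 1
  simp only [mul_add, mul_sub, mul_smul_comm, hu, hv, hw, ht, smul_add, smul_sub]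
  module

/-- If an element of an ideal `I` decomposes as `x₁ + x₀ + xα + xβ` into `ad a`-eigenvectors,
then every component lies in `I`;  moreover `I` is invariant under the Miyamoto map. -/
theorem stmt11 (F : Type*) [Field F] (V : Type*) [NonUnitalNonAssocCommRing V]
    [Module F V] [SMulCommClass F V V] [IsScalarTower F V V]
    (α β : F) (hα0 : α ≠ 0) (hα1 : α ≠ 1) (hβ0 : β ≠ 0) (hβ1 : β ≠ 1) (hαβ : α ≠ β)
    (a : V) (ha : a * a = a)
    (hass : eigSp F a 1 ⊔ eigSp F a 0 ⊔ eigSp F a α ⊔ eigSp F a β = ⊤)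
    (I : Submodule F V) (hI : ∀ v : V, ∀ x ∈ I, v * x ∈ I)
    (x₁ x₀ xα xβ : V)
    (hx₁ : x₁ ∈ eigSp F a 1) (hx₀ : x₀ ∈ eigSp F a 0)
    (hxα : xα ∈ eigSp F a α) (hxβ : xβ ∈ eigSp F a β)
    (hx : x₁ + x₀ + xα + xβ ∈ I) :
    x₁ ∈ I ∧ x₀ ∈ I ∧ xα ∈ I ∧ xβ ∈ I ∧
      (∀ τ : V ≃ₗ[F] V, IsMiyamoto F α β a τ → ∀ y ∈ I, τ y ∈ I) := by
  have comp : ∀ y₁ ∈ eigSp F a 1, ∀ y₀ ∈ eigSp F a 0, ∀ yα ∈ eigSp F a α, ∀ yβ ∈ eigSp F a β,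
      y₁ + y₀ + yα + yβ ∈ I → y₁ ∈ I ∧ y₀ ∈ I ∧ yα ∈ I ∧ yβ ∈ I := by
    intro y₁ h₁ y₀ h₀ yα hα yβ hβ h
    refine ⟨mem_of_add_mem_of_mem_eigSp one_ne_zero hα1.symm hβ1.symm (hI a) h₁ h₀ hα hβ h,
      mem_of_add_mem_of_mem_eigSp zero_ne_one hα0.symm hβ0.symm (hI a) h₀ h₁ hα hβ ?_,
      mem_of_add_mem_of_mem_eigSp hα1 hα0 hαβ (hI a) hα h₁ h₀ hβ ?_,
      mem_of_add_mem_of_mem_eigSp hβ1 hβ0 hαβ.symm (hI a) hβ h₁ h₀ hα ?_⟩ <;>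
    · convert h using 1
      abel
  obtain ⟨c₁, c₀, cα, cβ⟩ := comp x₁ hx₁ x₀ hx₀ xα hxα xβ hxβ hx
  refine ⟨c₁, c₀, cα, cβ, ?_⟩
  rintro τ ⟨τ₁, τ₀, τα, τβ⟩ y hy
  have hmem : y ∈ eigSp F a 1 ⊔ eigSp F a 0 ⊔ eigSp F a α ⊔ eigSp F a β :=
    hass ▸ Submodule.mem_top
  obtain ⟨u, hu, yβ, hβ, rfl⟩ := Submodule.mem_sup.1 hmem
  obtain ⟨w, hw, yα, hα, rfl⟩ := Submodule.mem_sup.1 hu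
  obtain ⟨y₁, h₁, y₀, h₀, rfl⟩ := Submodule.mem_sup.1 hw
  obtain ⟨d₁, d₀, dα, dβ⟩ := comp y₁ h₁ y₀ h₀ yα hα yβ hβ hy
  rw [map_add, map_add, map_add, τ₁ y₁ h₁, τ₀ y₀ h₀, τα yα hα, τβ yβ hβ]
  exact I.add_mem (I.add_mem (I.add_mem d₁ d₀) dα) (I.neg_mem dβ)
end

section
/- In the algebra V₃(β) (with char(F) ≠ 2 and 18β² − β − 1 = 0): (1) a₀·(a₁ − a₋₁) = β·(a₁ − a₋₁); (2) the vector v = −((3β+1)/8)·a₀ + (β/2)·(a₁ + a₋₁) satisfies a₀·v = 2β·v; (3) (3β+1)/(8β) = (9β+1)/4 and a₁ = ((9β+1)/4)·a₀ + (1/β)·v + (1/2)·(a₁ − a₋₁). -/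
/-- Computations in the algebra `V₃(β)` (basis `a₋₁, a₀, a₁`, with
`18β² - β - 1 = 0`):  `a₁ - a₋₁` is a `β`-eigenvector of `ad a₀`,
`v = -((3β+1)/8) a₀ + (β/2)(a₁ + a₋₁)` is a `2β`-eigenvector of `ad a₀`,
`(3β+1)/(8β) = (9β+1)/4` and
`a₁ = ((9β+1)/4) a₀ + (1/β) v + (1/2)(a₁ - a₋₁)`. -/
theorem stmt14 (F : Type*) [Field F] (V : Type*) [NonUnitalNonAssocCommRing V]
    [Module F V] [SMulCommClass F V V] [IsScalarTower F V V]
    (β : F) (hchar : (2 : F) ≠ 0) (hβ : 18 * β ^ 2 - β - 1 = 0)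
    (am a0 a1 : V)
    (hli : LinearIndependent F ![am, a0, a1])
    (hspan : Submodule.span F {am, a0, a1} = ⊤)
    (hmm : am * am = am) (h00 : a0 * a0 = a0) (h11 : a1 * a1 = a1)
    (hm0 : am * a0 = (3 * β / 2) • (am + a0) + (β / 2) • a1)
    (hm1 : am * a1 = (3 * β / 2) • (am + a1) + (β / 2) • a0)
    (h01 : a0 * a1 = (3 * β / 2) • (a0 + a1) + (β / 2) • am) :
    a0 * (a1 - am) = β • (a1 - am) ∧
      a0 * ((-((3 * β + 1) / 8)) • a0 + (β / 2) • (a1 + am)) =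
        (2 * β) • ((-((3 * β + 1) / 8)) • a0 + (β / 2) • (a1 + am)) ∧
      (3 * β + 1) / (8 * β) = (9 * β + 1) / 4 ∧
      a1 = ((9 * β + 1) / 4) • a0
        + (1 / β) • ((-((3 * β + 1) / 8)) • a0 + (β / 2) • (a1 + am))
        + (1 / 2 : F) • (a1 - am) := by
  have hβ0 : β ≠ 0 := by
    rintro rfl
    simp at hβ
  have h4 : (4 : F) ≠ 0 := by
    rw [show (4 : F) = 2 * 2 by norm_num]
    exact mul_ne_zero hchar hchar
  have h8 : (8 : F) ≠ 0 := by
    rw [show (8 : F) = 2 * 4 by norm_num]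
    exact mul_ne_zero hchar h4
  have h0m : a0 * am = (3 * β / 2) • (am + a0) + (β / 2) • a1 := by
    rw [mul_comm, hm0]
  have hcoeff : (3 * β + 1) / (8 * β) = (9 * β + 1) / 4 := by
    field_simp
    linear_combination -4 * hβ
  refine ⟨?_, ?_, hcoeff, ?_⟩
  · rw [mul_sub, h01, h0m]
    match_scalars <;> field_simp <;> ring
  · rw [mul_add, mul_smul_comm, mul_smul_comm, mul_add, h00, h01, h0m]
    match_scalars
    · field_simp
      linear_combination 4 * hβ
    · field_simp
      ring
    · field_simp
      ring
  · match_scalars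
    · field_simp
      ring
    · field_simp
      linear_combination -4 * hβ
    · field_simp
      ring
end

section
/- If char(F) ∉ {2, 3} and 18β² − β − 1 = 0 in F, then the algebra V₃(β) is simple: its only ideals are 0 and V₃(β). -/
section IdealsOfV3

variable {F V : Type*} [Field F] [NonUnitalNonAssocCommRing V] [Module F V]
  {β : F} {a b c : V} {I : Submodule F V}

/-- The `β`-component of `x = p • a + q • b + r • c`, under the action of the axis `b`,
lies in every ideal containing `x`. -/
theorem eq_or_sub_mem_of_mem_ideal [SMulCommClass F V V] (h2 : (2 : F) ≠ 0)
    (hβ0 : β ≠ 0) (hβ1 : β ≠ 1)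
    (hb : b * b = b) (hba : b * a = (3 * β / 2) • (b + a) + (β / 2) • c)
    (hbc : b * c = (3 * β / 2) • (b + c) + (β / 2) • a)
    (hI : ∀ v : V, ∀ x ∈ I, v * x ∈ I) {p q r : F}
    (hx : p • a + q • b + r • c ∈ I) : p = r ∨ a - c ∈ I := by
  refine or_iff_not_imp_left.2 fun hpr => ?_
  have hne : (1 - β) * β * (p - r) / 2 ≠ 0 :=
    div_ne_zero (mul_ne_zero (mul_ne_zero (sub_ne_zero.2 hβ1.symm) hβ0) (sub_ne_zero.2 hpr)) h2
  rw [← I.smul_mem_iff hne]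
  have hbx := hI b _ hx
  convert I.add_mem (I.sub_mem (hI b _ hbx) (I.smul_mem (1 + 2 * β) hbx))
    (I.smul_mem (2 * β) hx) using 1
  simp only [mul_add, mul_smul_comm, hb, hba, hbc]
  match_scalars <;> field_simp <;> ring

/-- An ideal containing one of the axes contains the other two. -/
theorem mem_ideal_of_axis_mem (h2 : (2 : F) ≠ 0) (hβ0 : β ≠ 0)
    (hba : b * a = (3 * β / 2) • (b + a) + (β / 2) • c)
    (hbc : b * c = (3 * β / 2) • (b + c) + (β / 2) • a)
    (hI : ∀ v : V, ∀ x ∈ I, v * x ∈ I) (hb : b ∈ I) : a ∈ I := by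
  have hne : 2 * β ^ 2 ≠ 0 := mul_ne_zero h2 (pow_ne_zero 2 hβ0)
  rw [← I.smul_mem_iff hne]
  have h1 : b * a ∈ I := mul_comm a b ▸ hI a b hb
  have h3 : b * c ∈ I := mul_comm c b ▸ hI c b hb
  rw [hba] at h1
  rw [hbc] at h3
  convert I.sub_mem (I.sub_mem (I.smul_mem (3 * β / 2) h1) (I.smul_mem (β / 2) h3))
    (I.smul_mem (3 * β ^ 2 / 2) hb) using 1
  match_scalars <;> field_simp <;> ring

/-- An ideal containing the difference of two axes contains the third. -/
theorem mem_ideal_of_sub_mem [SMulCommClass F V V] (h2 : (2 : F) ≠ 0)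
    (hβ0 : β ≠ 0) (hβ1 : β ≠ 1)
    (hβ7 : 7 * β ≠ 2) (hc : c * c = c)
    (hca : c * a = (3 * β / 2) • (c + a) + (β / 2) • b)
    (hcb : c * b = (3 * β / 2) • (c + b) + (β / 2) • a)
    (hI : ∀ v : V, ∀ x ∈ I, v * x ∈ I) (hac : a - c ∈ I) : b ∈ I := by
  have hw : (3 * β / 2) • a + (3 * β / 2 - 1) • c + (β / 2) • b ∈ I := by
    convert hI c _ hac using 1
    rw [mul_sub, hca, hc]
    module
  have hab : a - b ∈ I := by
    refine (eq_or_sub_mem_of_mem_ideal h2 hβ0 hβ1 hc hca hcb hI hw).resolve_left fun h => h2 ?_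
    field_simp at h
    linear_combination h
  have hne : (7 * β - 2) / 2 ≠ 0 := div_ne_zero (sub_ne_zero.2 hβ7) h2
  rw [← I.smul_mem_iff hne]
  convert I.sub_mem (I.add_mem hw (I.smul_mem (3 * β / 2 - 1) hac))
    (I.smul_mem (3 * β - 1) hab) using 1
  match_scalars <;> field_simp <;> ring

end IdealsOfV3

/-- If `char F ∉ {2, 3}` and `18β² - β - 1 = 0`, the algebra `V₃(β)` is simple. -/
theorem stmt15 (F : Type*) [Field F] (V : Type*) [NonUnitalNonAssocCommRing V]
    [Module F V] [SMulCommClass F V V] [IsScalarTower F V V]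
    (β : F) (hchar2 : (2 : F) ≠ 0) (hchar3 : (3 : F) ≠ 0)
    (hβ : 18 * β ^ 2 - β - 1 = 0)
    (am a0 a1 : V)
    (hli : LinearIndependent F ![am, a0, a1])
    (hspan : Submodule.span F {am, a0, a1} = ⊤)
    (hmm : am * am = am) (h00 : a0 * a0 = a0) (h11 : a1 * a1 = a1)
    (hm0 : am * a0 = (3 * β / 2) • (am + a0) + (β / 2) • a1)
    (hm1 : am * a1 = (3 * β / 2) • (am + a1) + (β / 2) • a0)
    (h01 : a0 * a1 = (3 * β / 2) • (a0 + a1) + (β / 2) • am) :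
    ∀ I : Submodule F V, (∀ v : V, ∀ x ∈ I, v * x ∈ I) → I = ⊥ ∨ I = ⊤ := by
  intro I hI
  have hβ0 : β ≠ 0 := by
    rintro rfl
    simp at hβ
  have hβ1 : β ≠ 1 := by
    rintro rfl
    exact pow_ne_zero 4 hchar2 (by linear_combination hβ)
  have hβm : 1 + β ≠ 0 := fun h =>
    mul_ne_zero hchar2 (pow_ne_zero 2 hchar3) (by linear_combination hβ - (18 * β - 19) * h)
  have hβ7 : 7 * β ≠ 2 := fun h =>
    pow_ne_zero 2 hchar3 (by linear_combination 49 * hβ - (126 * β + 29) * h)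
  have h0m : a0 * am = (3 * β / 2) • (a0 + am) + (β / 2) • a1 := by
    rw [mul_comm, hm0, add_comm am]
  have h1m : a1 * am = (3 * β / 2) • (a1 + am) + (β / 2) • a0 := by
    rw [mul_comm, hm1, add_comm am]
  have h10 : a1 * a0 = (3 * β / 2) • (a1 + a0) + (β / 2) • am := by
    rw [mul_comm, h01, add_comm a0]
  have htop (h : a0 ∈ I) : I = ⊤ := by
    rw [eq_top_iff, ← hspan, Submodule.span_le]
    rintro x (rfl | rfl | rfl)
    · exact mem_ideal_of_axis_mem hchar2 hβ0 h0m h01 hI h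
    · exact h
    · exact mem_ideal_of_axis_mem hchar2 hβ0 h01 h0m hI h
  refine or_iff_not_imp_left.2 fun hbot => htop ?_
  obtain ⟨x, hx, hx0⟩ := I.exists_mem_ne_zero_of_ne_bot hbot
  have hxs : x ∈ Submodule.span F {am, a0, a1} := hspan ▸ Submodule.mem_top
  obtain ⟨p, q, r, rfl⟩ := Submodule.mem_span_triple.1 hxs
  rcases eq_or_sub_mem_of_mem_ideal hchar2 hβ0 hβ1 h00 h0m h01 hI hx with rfl | h
  · have hx' : p • am + p • a1 + q • a0 ∈ I := by rwa [add_right_comm]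
    rcases eq_or_sub_mem_of_mem_ideal hchar2 hβ0 hβ1 h11 h1m h10 hI hx' with rfl | h
    · have hp : p ≠ 0 := by
        rintro rfl
        simp at hx0
      rw [← I.smul_mem_iff (mul_ne_zero hβm hp)]
      convert I.sub_mem (hI a0 _ hx) (I.smul_mem (2 * β) hx) using 1
      simp only [mul_add, mul_smul_comm, h00, h0m, h01]
      match_scalars <;> field_simp <;> ring
    · have h1 := mem_ideal_of_sub_mem hchar2 hβ0 hβ1 hβ7 h00 h0m h01 hI h
      exact mem_ideal_of_axis_mem hchar2 hβ0 h10 h1m hI h1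
  · exact mem_ideal_of_sub_mem hchar2 hβ0 hβ1 hβ7 h11 h1m h10 hI h
end

section
/- The symmetric bilinear form b on Y₅(β) defined on the basis by b(a_i, a_i) = 1, b(a_i, a_j) = β + 1/4 whenever i − j is odd, b(a₀, a₂) = b(a₁, a₃) = β, b(a_i, s) = β/4 for all i, and b(s, s) = β/8, is a Frobenius form: b(x·y, z) = b(x, y·z) for all x, y, z ∈ Y₅(β). -/
/-- Associativity of a bilinear form with respect to a bilinear product can be checked on a
spanning set. -/
theorem LinearMap.apply_mul_eq_apply_mul_of_span_eq_top {F V : Type*} [Field F]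
    [NonUnitalNonAssocCommRing V] [Module F V] [SMulCommClass F V V] [IsScalarTower F V V]
    (B : V →ₗ[F] V →ₗ[F] F) {S : Set V} (hS : Submodule.span F S = ⊤)
    (h : ∀ x ∈ S, ∀ y ∈ S, ∀ z ∈ S, B (x * y) z = B x (y * z)) (x y z : V) :
    B (x * y) z = B x (y * z) := by
  have mem (v : V) : v ∈ Submodule.span F S := hS ▸ Submodule.mem_top
  induction mem x using Submodule.span_induction with
  | zero => simp
  | add u v _ _ hu hv => simp [add_mul, hu, hv]
  | smul c u _ hu => simp [smul_mul_assoc, hu]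
  | mem x hx =>
    induction mem y using Submodule.span_induction with
    | zero => simp
    | add u v _ _ hu hv => simp [mul_add, add_mul, hu, hv]
    | smul c u _ hu => simp [smul_mul_assoc, mul_smul_comm, hu]
    | mem y hy =>
      induction mem z using Submodule.span_induction with
      | zero => simp
      | add u v _ _ hu hv => simp [mul_add, hu, hv]
      | smul c u _ hu => simp [mul_smul_comm, hu]
      | mem z hz => exact h x hx y hy z hz

set_option maxHeartbeats 1600000 in
/-- The symmetric bilinear form on `Y₅(β)` with `b(a i, a i) = 1`,
`b(a i, a j) = β + 1/4` for `i - j` odd, `b(a i, a (i+2)) = β`, `b(a i, s) = β/4` and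
`b(s, s) = β/8` is a Frobenius form. -/
theorem stmt17 (F : Type*) [Field F] (V : Type*) [NonUnitalNonAssocCommRing V]
    [Module F V] [SMulCommClass F V V] [IsScalarTower F V V]
    (β : F) (hchar : (2 : F) ≠ 0) (hβ : 4 * β ^ 2 + 2 * β - 1 = 0)
    (a : ZMod 4 → V) (s : V)
    (hli : LinearIndependent F ![a 0, a 1, a 2, a 3, s])
    (hspan : Submodule.span F {a 0, a 1, a 2, a 3, s} = ⊤)
    (hidem : ∀ i : ZMod 4, a i * a i = a i)
    (hadj : ∀ i : ZMod 4, a i * a (i + 1) = s + β • (a i + a (i + 1)))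
    (hopp : ∀ i : ZMod 4, a i * a (i + 2) =
      (4 * β) • s - ((2 * β - 1) / 2) • (a (i + 1) + a (i + 3)))
    (has : ∀ i : ZMod 4, a i * s = β • s + (β ^ 2 / 2) • (a (i - 1) + a (i + 1)))
    (hss : s * s = ((3 * β - 1) / 8) • ((4 : F) • s - a 0 - a 1 - a 2 - a 3))
    (B : V →ₗ[F] V →ₗ[F] F)
    (hBsymm : ∀ x y : V, B x y = B y x)
    (hBaa : ∀ i : ZMod 4, B (a i) (a i) = 1)
    (hBadj : ∀ i : ZMod 4, B (a i) (a (i + 1)) = β + 1 / 4)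
    (hBopp : ∀ i : ZMod 4, B (a i) (a (i + 2)) = β)
    (hBas : ∀ i : ZMod 4, B (a i) s = β / 4)
    (hBss : B s s = β / 8) :
    ∀ x y z : V, B (x * y) z = B x (y * z) := by
  have m01 : a 0 * a 1 = s + β • (a 0 + a 1) := hadj 0
  have b01 : B (a 0) (a 1) = β + 1 / 4 := hBadj 0
  have m10 : a 1 * a 0 = s + β • (a 0 + a 1) := mul_comm (a 1) (a 0) ▸ m01
  have b10 : B (a 1) (a 0) = β + 1 / 4 := hBsymm (a 1) (a 0) ▸ b01
  have m12 : a 1 * a 2 = s + β • (a 1 + a 2) := hadj 1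
  have b12 : B (a 1) (a 2) = β + 1 / 4 := hBadj 1
  have m21 : a 2 * a 1 = s + β • (a 1 + a 2) := mul_comm (a 2) (a 1) ▸ m12
  have b21 : B (a 2) (a 1) = β + 1 / 4 := hBsymm (a 2) (a 1) ▸ b12
  have m23 : a 2 * a 3 = s + β • (a 2 + a 3) := hadj 2
  have b23 : B (a 2) (a 3) = β + 1 / 4 := hBadj 2
  have m32 : a 3 * a 2 = s + β • (a 2 + a 3) := mul_comm (a 3) (a 2) ▸ m23
  have b32 : B (a 3) (a 2) = β + 1 / 4 := hBsymm (a 3) (a 2) ▸ b23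
  have m30 : a 3 * a 0 = s + β • (a 3 + a 0) := hadj 3
  have b30 : B (a 3) (a 0) = β + 1 / 4 := hBadj 3
  have m03 : a 0 * a 3 = s + β • (a 3 + a 0) := mul_comm (a 0) (a 3) ▸ m30
  have b03 : B (a 0) (a 3) = β + 1 / 4 := hBsymm (a 0) (a 3) ▸ b30
  have m02 : a 0 * a 2 = (4 * β) • s - ((2 * β - 1) / 2) • (a 1 + a 3) := hopp 0
  have b02 : B (a 0) (a 2) = β := hBopp 0
  have m13 : a 1 * a 3 = (4 * β) • s - ((2 * β - 1) / 2) • (a 2 + a 0) := hopp 1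
  have b13 : B (a 1) (a 3) = β := hBopp 1
  have m20 : a 2 * a 0 = (4 * β) • s - ((2 * β - 1) / 2) • (a 3 + a 1) := hopp 2
  have b20 : B (a 2) (a 0) = β := hBopp 2
  have m31 : a 3 * a 1 = (4 * β) • s - ((2 * β - 1) / 2) • (a 0 + a 2) := hopp 3
  have b31 : B (a 3) (a 1) = β := hBopp 3
  have m0s : a 0 * s = β • s + (β ^ 2 / 2) • (a 3 + a 1) := has 0
  have m1s : a 1 * s = β • s + (β ^ 2 / 2) • (a 0 + a 2) := has 1
  have m2s : a 2 * s = β • s + (β ^ 2 / 2) • (a 1 + a 3) := has 2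
  have m3s : a 3 * s = β • s + (β ^ 2 / 2) • (a 2 + a 0) := has 3
  have ms (i : ZMod 4) : s * a i = a i * s := mul_comm _ _
  have bs (i : ZMod 4) : B s (a i) = β / 4 := (hBsymm _ _).trans (hBas i)
  have h4 : (4 : F) ≠ 0 := by convert pow_ne_zero 2 hchar using 1; norm_num
  have h8 : (8 : F) ≠ 0 := by convert pow_ne_zero 3 hchar using 1; norm_num
  refine B.apply_mul_eq_apply_mul_of_span_eq_top hspan ?_
  rintro x (rfl | rfl | rfl | rfl | rfl) y (rfl | rfl | rfl | rfl | rfl) z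
    (rfl | rfl | rfl | rfl | rfl) <;>
  simp only [hidem, hss, ms, bs, hBaa, hBas, hBss,
    m01, m02, m03, m10, m12, m13,
    m20, m21, m23, m30, m31, m32, m0s, m1s, m2s, m3s,
    b01, b02, b03, b10, b12, b13,
    b20, b21, b23, b30, b31, b32,
    map_add, map_sub, map_smul, LinearMap.add_apply, LinearMap.sub_apply, LinearMap.smul_apply,
    smul_eq_mul] <;>
  clear * - hchar h4 h8 hβ <;> grind
end

section
/- If β ≠ 2, then the algebra 3C(β) is generated as an F-algebra by the two elements a₋₁ − a₁ and a₀ − a₁. -/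
/-- If `β ≠ 2`, the algebra `3C(β)` is generated as an `F`-algebra by `a₋₁ - a₁`
and `a₀ - a₁`. -/
theorem stmt19 (F : Type*) [Field F] (V : Type*) [NonUnitalNonAssocCommRing V]
    [Module F V] [SMulCommClass F V V] [IsScalarTower F V V]
    (β : F) (hchar : (2 : F) ≠ 0) (hβ0 : β ≠ 0) (hβ1 : β ≠ 1) (hβ2 : β ≠ 2)
    (am a0 a1 : V)
    (hli : LinearIndependent F ![am, a0, a1])
    (hspan : Submodule.span F {am, a0, a1} = ⊤)
    (hmm : am * am = am) (h00 : a0 * a0 = a0) (h11 : a1 * a1 = a1)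
    (hm0 : am * a0 = (β / 2) • (am + a0 - a1))
    (hm1 : am * a1 = (β / 2) • (am + a1 - a0))
    (h01 : a0 * a1 = (β / 2) • (a0 + a1 - am)) :
    NonUnitalAlgebra.adjoin F {am - a1, a0 - a1} = ⊤ := by
  set S := NonUnitalAlgebra.adjoin F {am - a1, a0 - a1}
  have hx : am - a1 ∈ S := NonUnitalAlgebra.subset_adjoin F (by simp)
  have hy : a0 - a1 ∈ S := NonUnitalAlgebra.subset_adjoin F (by simp)
  have hβ : (2 : F) - β ≠ 0 := sub_ne_zero.mpr hβ2.symm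
  have hsq : (am - a1) * (am - a1) =
      (1 - β) • (am - a1) + β • (a0 - a1) + (2 - β) • a1 := by
    rw [sub_mul, mul_sub, mul_sub, mul_comm a1 am, hmm, h11, hm1]
    match_scalars <;> field_simp <;> ring
  have h1 : a1 ∈ S := by
    have h : (2 - β) • a1 ∈ S := by
      rw [← sub_eq_of_eq_add' hsq]
      exact sub_mem (mul_mem hx hx) (add_mem (SMulMemClass.smul_mem _ hx) (SMulMemClass.smul_mem _ hy))
    simpa [smul_smul, inv_mul_cancel₀ hβ] using SMulMemClass.smul_mem (2 - β)⁻¹ h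
  have hm : am ∈ S := by simpa using add_mem hx h1
  have h0 : a0 ∈ S := by simpa using add_mem hy h1
  have hle : Submodule.span F {am, a0, a1} ≤ S.toSubmodule := by
    rw [Submodule.span_le]
    rintro z (rfl | rfl | rfl) <;> assumption
  rw [hspan] at hle
  exact eq_top_iff.mpr fun z _ => hle (Submodule.mem_top (x := z))
end
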